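/- arXiv:2106.14389 — 2 statements merged into one kernel-verified Lean document; each statement's English description precedes it below -/
import Mathlib

section
/- Let (p_i)_{i≥0} be nonnegative reals with ∑_{i≥0} p_i = 1 and p_0 ∈ (0,1), and let f(s) = ∑_{i≥0} p_i s^i for s ∈ [0,1]. Then for every integer s ≥ 2 there exists q ∈ [0,1] satisfying q = g_q(g_q(⋯ g_q(0) ⋯)), where the map g_q : [0,1] → [0,1] defined by g_q(z) = 1 − f(q + (1−q)z) is iterated s−1 times. -/
open Set in
/-- A power series with nonnegative coefficients of sum one maps the unit interval to itself. -/
theorem tsum_mul_pow_mem_Icc {p : ℕ → ℝ} (hp : ∀ i, 0 ≤ p i) (hsum : HasSum p 1)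
    {x : ℝ} (hx : x ∈ Icc (0 : ℝ) 1) : ∑' i, p i * x ^ i ∈ Icc (0 : ℝ) 1 := by
  have hle : ∀ i, p i * x ^ i ≤ p i := fun i =>
    mul_le_of_le_one_right (hp i) (pow_le_one₀ hx.1 hx.2)
  have hnonneg : ∀ i, 0 ≤ p i * x ^ i := fun i => mul_nonneg (hp i) (pow_nonneg hx.1 i)
  refine ⟨tsum_nonneg hnonneg, ?_⟩
  rw [← hsum.tsum_eq]
  exact (hsum.summable.of_nonneg_of_le hnonneg hle).tsum_le_tsum hle hsum.summable

open Set in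
/-- A power series with nonnegative summable coefficients is continuous on the unit interval. -/
theorem continuousOn_tsum_mul_pow {p : ℕ → ℝ} (hp : ∀ i, 0 ≤ p i) (hsum : Summable p) :
    ContinuousOn (fun x : ℝ => ∑' i, p i * x ^ i) (Icc 0 1) := by
  refine continuousOn_tsum (fun i => by fun_prop) hsum fun i x hx => ?_
  rw [Real.norm_of_nonneg (mul_nonneg (hp i) (pow_nonneg hx.1 i))]
  exact mul_le_of_le_one_right (hp i) (pow_le_one₀ hx.1 hx.2)

open Set in
/-- If `f` is a continuous self-map of the unit interval, then the iterates at `0` of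
`z ↦ 1 - f (q + (1 - q) * z)` stay in the unit interval and depend continuously on `q`. -/
theorem continuousOn_mapsTo_iterate_one_sub {f : ℝ → ℝ} (hf : ContinuousOn f (Icc 0 1))
    (hmaps : MapsTo f (Icc 0 1) (Icc 0 1)) (n : ℕ) :
    ContinuousOn (fun q : ℝ => (fun z : ℝ => 1 - f (q + (1 - q) * z))^[n] 0) (Icc 0 1) ∧
      MapsTo (fun q : ℝ => (fun z : ℝ => 1 - f (q + (1 - q) * z))^[n] 0)
        (Icc 0 1) (Icc 0 1) := by
  induction n with
  | zero => exact ⟨continuousOn_const, fun _ _ => by simp⟩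
  | succ n ih =>
    obtain ⟨hcont, hmem⟩ := ih
    simp only [Function.iterate_succ_apply']
    have hinner : MapsTo (fun q : ℝ => q + (1 - q) *
        (fun z : ℝ => 1 - f (q + (1 - q) * z))^[n] 0) (Icc 0 1) (Icc 0 1) := by
      intro q hq
      have hz := hmem hq
      simp only [mem_Icc] at hq hz ⊢
      constructor <;> nlinarith
    refine ⟨continuousOn_const.sub (hf.comp (continuousOn_id.add
      ((continuousOn_const.sub continuousOn_id).mul hcont)) hinner), fun q hq => ?_⟩
    have h := hmaps (hinner hq)
    simp only [mem_Icc] at h ⊢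
    constructor <;> linarith


/-- For an offspring distribution `(p i)` with `p 0 ∈ (0,1)` and
generating function `f`, for every integer `s ≥ 2` there exists `q ∈ [0,1]`
satisfying the fixed-point equation `q = g_q^{(s-1)}(0)` where
`g_q z = 1 - f (q + (1-q) z)`. -/
theorem s_path_cover_fixed_point_exists
    (p : ℕ → ℝ) (hp : ∀ i, 0 ≤ p i) (hsum : ∑' i, p i = 1)
    (hp0 : p 0 ∈ Set.Ioo (0 : ℝ) 1) (s : ℕ) (hs : 2 ≤ s) :
    ∃ q ∈ Set.Icc (0 : ℝ) 1,
      q = (fun z : ℝ => 1 - ∑' i, p i * (q + (1 - q) * z) ^ i)^[s - 1] 0 := by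
  have hasSum : HasSum p 1 := by
    have hsummable : Summable p := by
      by_contra h
      simp [tsum_eq_zero_of_not_summable h] at hsum
    exact hsum ▸ hsummable.hasSum
  obtain ⟨hcont, hmaps⟩ := continuousOn_mapsTo_iterate_one_sub
    (continuousOn_tsum_mul_pow hp hasSum.summable)
    (fun _ hx => tsum_mul_pow_mem_Icc hp hasSum hx) (s - 1)
  obtain ⟨q, hq, hfix⟩ := exists_mem_Icc_isFixedPt_of_mapsTo hcont zero_le_one hmaps
  exact ⟨q, hq, hfix.symm⟩
end

section
/- Let (p_i)_{i≥0} be nonnegative reals with ∑_{i≥0} p_i = 1, p_0 ∈ (0,1), mean ∑_{i≥0} i·p_i = 1, and 0 < ∑_{i≥0} i(i−1)p_i < ∞; let f(s) = ∑_{i≥0} p_i s^i, f'(s) = ∑_{i≥1} i·p_i s^{i−1}, and let q be the unique solution in (1/2,1) of q = f(1−q). Suppose (r_i)_{i≥0} is a sequence of nonnegative reals such that r_0 = p_0, ∑_{i≥0} r_{2i} = q, ∑_{i≥0} r_{2i+1} = 1−q, and for all i ≥ 1: r_{2i} = f(∑_{odd j ≤ 2i−1} r_j) − f(∑_{odd j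 ≤ 2i−3} r_j) and r_{2i−1} = f(1−q + ∑_{even j ≥ 2i−2} r_j) − f(1−q + ∑_{even j ≥ 2i} r_j) (sums over odd resp. even indices j in the indicated ranges, an empty sum being 0). Then r_i > 0 for all i and r_{i+1}/r_i → f'(1−q) as i → ∞. -/
open Filter

/-- Convergence along the even and along the odd indices gives convergence. -/
theorem tendsto_atTop_of_tendsto_even_odd {α : Type*} {u : ℕ → α} {l : Filter α}
    (he : Tendsto (fun n => u (2 * n)) atTop l)
    (ho : Tendsto (fun n => u (2 * n + 1)) atTop l) : Tendsto u atTop l := by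
  intro s hs
  obtain ⟨a, ha⟩ := mem_atTop_sets.1 (he hs)
  obtain ⟨b, hb⟩ := mem_atTop_sets.1 (ho hs)
  refine mem_atTop_sets.2 ⟨2 * (a + b), fun n hn => ?_⟩
  obtain ⟨k, rfl | rfl⟩ := Nat.even_or_odd' n
  · exact ha k (by omega)
  · exact hb k (by omega)

/-- If `f` is strictly differentiable at `c`, then its difference quotients along two sequences
tending to `c` tend to the derivative. -/
theorem HasStrictDerivAt.tendsto_div_sub {f : ℝ → ℝ} {d c : ℝ} (h : HasStrictDerivAt f d c)
    {x y : ℕ → ℝ} (hx : Tendsto x atTop (nhds c)) (hy : Tendsto y atTop (nhds c))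
    (hxy : ∀ n, x n ≠ y n) :
    Tendsto (fun n => (f (x n) - f (y n)) / (x n - y n)) atTop (nhds d) := by
  have h1 := (h.isLittleO.comp_tendsto (hx.prodMk_nhds hy)).tendsto_div_nhds_zero
  have h2 := h1.add_const d
  rw [zero_add] at h2
  refine h2.congr fun n => ?_
  have : x n - y n ≠ 0 := sub_ne_zero.2 (hxy n)
  simp only [Function.comp_apply, ContinuousLinearMap.toSpanSingleton_apply, smul_eq_mul]
  field_simp
  ring

theorem summable_mul_pow_of_mem_Icc {p : ℕ → ℝ} (hp : ∀ i, 0 ≤ p i) (hs : Summable p)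
    {s : ℝ} (h : s ∈ Set.Icc (0 : ℝ) 1) : Summable fun i => p i * s ^ i :=
  hs.of_nonneg_of_le (fun i => mul_nonneg (hp i) (pow_nonneg h.1 i))
    fun i => mul_le_of_le_one_right (hp i) (pow_le_one₀ h.1 h.2)

/-- A power series with nonnegative summable coefficients, not all zero beyond the constant one,
is strictly increasing on `[0, 1]`. -/
theorem strictMonoOn_tsum_mul_pow {p : ℕ → ℝ} (hp : ∀ i, 0 ≤ p i) (hs : Summable p)
    {m : ℕ} (hm : m ≠ 0) (hpm : 0 < p m) :
    StrictMonoOn (fun s : ℝ => ∑' i, p i * s ^ i) (Set.Icc 0 1) := fun _ hx _ hy hxy =>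
  Summable.tsum_lt_tsum (i := m)
    (fun i => mul_le_mul_of_nonneg_left (pow_le_pow_left₀ hx.1 hxy.le i) (hp i))
    (mul_lt_mul_of_pos_left (pow_lt_pow_left₀ hxy hx.1 hm) hpm)
    (summable_mul_pow_of_mem_Icc hp hs hx) (summable_mul_pow_of_mem_Icc hp hs hy)

/-- A power series with nonnegative coefficients and finite mean is strictly differentiable
in `(0, 1)`, with the termwise derivative. -/
theorem hasStrictDerivAt_tsum_mul_pow {p : ℕ → ℝ} (hp : ∀ i, 0 ≤ p i) (hs : Summable p)
    (hmean : Summable fun i : ℕ => (i : ℝ) * p i) {c : ℝ} (hc : c ∈ Set.Ioo (0 : ℝ) 1) :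
    HasStrictDerivAt (fun s : ℝ => ∑' i, p i * s ^ i)
      (∑' i : ℕ, (i : ℝ) * p i * c ^ (i - 1)) c := by
  have hbound : ∀ (i : ℕ), ∀ s ∈ Set.Ioo (0 : ℝ) 1,
      ‖(i : ℝ) * p i * s ^ (i - 1)‖ ≤ (i : ℝ) * p i := fun i s hs => by
    have h0 : 0 ≤ (i : ℝ) * p i := mul_nonneg i.cast_nonneg (hp i)
    rw [Real.norm_of_nonneg (mul_nonneg h0 (pow_nonneg hs.1.le _))]
    exact mul_le_of_le_one_right h0 (pow_le_one₀ hs.1.le hs.2.le)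
  have hnhds : Set.Ioo (0 : ℝ) 1 ∈ nhds c := isOpen_Ioo.mem_nhds hc
  refine hasStrictDerivAt_of_hasDerivAt_of_continuousAt
    (f' := fun s => ∑' i : ℕ, (i : ℝ) * p i * s ^ (i - 1)) ?_ ?_
  · filter_upwards [hnhds] with s hs'
    refine hasDerivAt_tsum_of_isPreconnected hmean isOpen_Ioo isPreconnected_Ioo
      (fun i t _ => ?_) hbound hc
      (summable_mul_pow_of_mem_Icc hp hs (Set.Ioo_subset_Icc_self hc)) hs'
    exact ((hasDerivAt_pow i t).const_mul (p i)).congr_deriv (by ring)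
  · exact (continuousOn_tsum (fun i => by fun_prop) hmean hbound).continuousAt hnhds

/-- For a critical offspring distribution with finite nonzero second
factorial moment, the peel-number distribution `(r i)` (satisfying the recurrences
derived in the paper) satisfies `r i > 0` and satisfies the ratio asymptotic
`r (i+1) / r i → f'(1-q)`. -/
theorem peel_number_distribution_ratio_asymptotics
    (p : ℕ → ℝ) (hp : ∀ i, 0 ≤ p i) (hsum : ∑' i, p i = 1)
    (hp0 : p 0 ∈ Set.Ioo (0 : ℝ) 1)
    (hmean_summable : Summable (fun i : ℕ => (i : ℝ) * p i))
    (hmean : ∑' i : ℕ, (i : ℝ) * p i = 1)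
    (hvar_summable : Summable (fun i : ℕ => (i : ℝ) * ((i : ℝ) - 1) * p i))
    (hvar_pos : 0 < ∑' i : ℕ, (i : ℝ) * ((i : ℝ) - 1) * p i)
    (f : ℝ → ℝ) (hf : ∀ s ∈ Set.Icc (0 : ℝ) 1, f s = ∑' i, p i * s ^ i)
    (f' : ℝ → ℝ)
    (hf' : ∀ s ∈ Set.Icc (0 : ℝ) 1, f' s = ∑' i : ℕ, (i : ℝ) * p i * s ^ (i - 1))
    (q : ℝ) (hq : q ∈ Set.Ioo (1 / 2 : ℝ) 1) (hqfix : q = f (1 - q))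
    (r : ℕ → ℝ) (hr : ∀ i, 0 ≤ r i)
    (hr0 : r 0 = p 0)
    (hreven_sum : ∑' i : ℕ, r (2 * i) = q)
    (hrodd_sum : ∑' i : ℕ, r (2 * i + 1) = 1 - q)
    (hreven : ∀ i : ℕ, 1 ≤ i →
      r (2 * i) = f (∑ k ∈ Finset.range i, r (2 * k + 1)) -
        f (∑ k ∈ Finset.range (i - 1), r (2 * k + 1)))
    (hrodd : ∀ i : ℕ, 1 ≤ i →
      r (2 * i - 1) = f (1 - q + ∑' k : ℕ, r (2 * (k + (i - 1)))) -
        f (1 - q + ∑' k : ℕ, r (2 * (k + i)))) :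
    (∀ i, 0 < r i) ∧
      Tendsto (fun i : ℕ => r (i + 1) / r i) atTop (nhds (f' (1 - q))) := by
  have hps : Summable p := by
    by_contra h
    simp [tsum_eq_zero_of_not_summable h] at hsum
  have hes : Summable fun i => r (2 * i) := by
    by_contra h
    rw [tsum_eq_zero_of_not_summable h] at hreven_sum
    linarith [hq.1]
  have hos : Summable fun i => r (2 * i + 1) := by
    by_contra h
    rw [tsum_eq_zero_of_not_summable h] at hrodd_sum
    linarith [hq.2]
  obtain ⟨m, hm, hpm⟩ : ∃ m, m ≠ 0 ∧ 0 < p m := by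
    by_contra! h
    have h0 : ∀ i : ℕ, (i : ℝ) * p i = 0 := fun i => by
      rcases eq_or_ne i 0 with rfl | hi
      · simp
      · rw [le_antisymm (h i hi) (hp i), mul_zero]
    simp [h0] at hmean
  have hmono : StrictMonoOn f (Set.Icc 0 1) := (strictMonoOn_tsum_mul_pow hp hps hm hpm).congr
    fun s hs => (hf s hs).symm
  have hc : 1 - q ∈ Set.Ioo (0 : ℝ) 1 := ⟨by linarith [hq.2], by linarith [hq.1]⟩
  have hderiv : HasStrictDerivAt f (f' (1 - q)) (1 - q) := by
    rw [hf' _ (Set.Ioo_subset_Icc_self hc)]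
    refine (hasStrictDerivAt_tsum_mul_pow hp hps hmean_summable hc).congr_of_eventuallyEq ?_
    filter_upwards [isOpen_Ioo.mem_nhds hc] with s hs
    exact (hf s (Set.Ioo_subset_Icc_self hs)).symm
  set A : ℕ → ℝ := fun n => ∑ k ∈ Finset.range n, r (2 * k + 1) with hA
  set B : ℕ → ℝ := fun n => 1 - q + ∑' k : ℕ, r (2 * (k + n)) with hB
  have hAsucc : ∀ n, A (n + 1) - A n = r (2 * n + 1) := fun n => by
    simp [hA, Finset.sum_range_succ]
  have hBsucc : ∀ n, B n - B (n + 1) = r (2 * n) := fun n => by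
    have h := ((summable_nat_add_iff n).2 hes).tsum_eq_zero_add
    simp only [zero_add, add_assoc, add_comm 1 n] at h
    simp only [hB]
    linarith
  have hAmem : ∀ n, A n ∈ Set.Icc (0 : ℝ) 1 := fun n =>
    ⟨Finset.sum_nonneg fun _ _ => hr _,
      ((hos.sum_le_tsum _ fun _ _ => hr _).trans_eq hrodd_sum).trans hc.2.le⟩
  have hBmem : ∀ n, B n ∈ Set.Icc (0 : ℝ) 1 := fun n => by
    have h := hes.sum_add_tsum_nat_add n
    have h1 : 0 ≤ ∑ k ∈ Finset.range n, r (2 * k) := Finset.sum_nonneg fun _ _ => hr _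
    have h2 : 0 ≤ ∑' k : ℕ, r (2 * (k + n)) := tsum_nonneg fun _ => hr _
    simp only [hB]
    exact ⟨by linarith [hc.1], by linarith⟩
  have hAlim : Tendsto A atTop (nhds (1 - q)) := hrodd_sum ▸ hos.hasSum.tendsto_sum_nat
  have hBlim : Tendsto B atTop (nhds (1 - q)) := by
    simpa using (tendsto_sum_nat_add fun i => r (2 * i)).const_add (1 - q)
  have hrA : ∀ n, r (2 * n + 2) = f (A (n + 1)) - f (A n) := fun n => hreven (n + 1) n.succ_pos
  have hrB : ∀ n, r (2 * n + 1) = f (B n) - f (B (n + 1)) := fun n => hrodd (n + 1) n.succ_pos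
  have hpos_odd : ∀ n, 0 < r (2 * n) → 0 < r (2 * n + 1) := fun n h => by
    rw [hrB, sub_pos]
    exact hmono (hBmem _) (hBmem _) (sub_pos.1 (by rwa [hBsucc]))
  have hpos_even : ∀ n, 0 < r (2 * n) := fun n => by
    induction n with
    | zero => exact hr0 ▸ hp0.1
    | succ n ih =>
      rw [mul_add_one, hrA, sub_pos]
      exact hmono (hAmem _) (hAmem _) (sub_pos.1 (by rw [hAsucc]; exact hpos_odd n ih))
  refine ⟨fun i => ?_, tendsto_atTop_of_tendsto_even_odd ?_ ?_⟩
  · obtain ⟨k, rfl | rfl⟩ := Nat.even_or_odd' i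
    exacts [hpos_even k, hpos_odd k (hpos_even k)]
  · refine (hderiv.tendsto_div_sub hBlim (hBlim.comp (tendsto_add_atTop_nat 1))
      fun n => ?_).congr fun n => ?_
    · exact sub_ne_zero.1 ((hBsucc n).trans_ne (hpos_even n).ne')
    · simp only [Function.comp_apply, hBsucc, ← hrB]
  · refine (hderiv.tendsto_div_sub (hAlim.comp (tendsto_add_atTop_nat 1)) hAlim
      fun n => ?_).congr fun n => ?_
    · exact sub_ne_zero.1 ((hAsucc n).trans_ne (hpos_odd n (hpos_even n)).ne')
    · simp only [Function.comp_apply, hAsucc, ← hrA]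
end
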